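/- arXiv:1010.4190 — 2 statements merged into one kernel-verified Lean document; each statement's English description precedes it below -/
import Mathlib

section
/- Let n ≥ 2 and for a continuously differentiable function f : ℝⁿ → ℝ write ∇f for its gradient and e₁ = (1,0,…,0). Then: (i) the infimum over all continuously differentiable f : ℝⁿ → ℝ of sup_{q ∈ ℝⁿ} ½‖∇f(q) + e₁‖² equals 0 (attained by f(q) = -q₁); (ii) the infimum of the same quantity taken only over those continuously differentiable f : ℝⁿ → ℝ such that for every c ∈ ℝ^{n-1} the function t ↦ f(t,c) is bounded on ℝ equals ½ (attained by f = 0). In particular, for every f that is bounded along each horizontal line t ↦ (t,c), one has sup_{q ∈ ℝⁿ} ½‖∇f(q) + e₁‖² ≥ ½. -/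
open scoped ENNReal

/-- A differentiable function that is bounded along a line in the direction of a unit vector `v`
satisfies `sup ½‖∇f + v‖² ≥ ½`. -/
theorem half_le_iSup_norm_gradient_add_sq {E : Type*} [NormedAddCommGroup E]
    [InnerProductSpace ℝ E] [CompleteSpace E] {f : E → ℝ} (hf : Differentiable ℝ f) {v : E}
    (hv : ‖v‖ = 1) {p : E} {C : ℝ} (hC : ∀ t : ℝ, |f (p + t • v)| ≤ C) :
    (1/2 : ℝ≥0∞) ≤ ⨆ q : E, ENNReal.ofReal ((1/2) * ‖gradient f q + v‖^2) := by
  by_contra! hlt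
  obtain ⟨r, hr⟩ := WithTop.ne_top_iff_exists.mp hlt.ne_top
  have hr_half : (r : ℝ) < 1/2 := by
    rw [← hr] at hlt
    simpa using (ENNReal.toReal_lt_toReal ENNReal.coe_ne_top (by simp)).mpr hlt
  have hle (q : E) : (1/2) * ‖gradient f q + v‖^2 ≤ r := by
    have h : ENNReal.ofReal ((1/2) * ‖gradient f q + v‖^2) ≤ r :=
      (le_iSup (fun q ↦ ENNReal.ofReal ((1/2) * ‖gradient f q + v‖^2)) q).trans_eq hr.symm
    simpa using (ENNReal.ofReal_le_iff_le_toReal ENNReal.coe_ne_top).mp h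
  have hderiv (t : ℝ) :
      HasDerivAt (fun t : ℝ ↦ f (p + t • v)) (inner ℝ (gradient f (p + t • v)) v) t := by
    have hline : HasDerivAt (fun t : ℝ ↦ p + t • v) v t := by
      simpa using ((hasDerivAt_id t).smul_const v).const_add p
    simpa [Function.comp_def] using
      (hf (p + t • v)).hasGradientAt.hasFDerivAt.comp_hasDerivAt t hline
  have hslope (t : ℝ) : deriv (fun t : ℝ ↦ f (p + t • v)) t ≤ r - 1/2 := by
    rw [(hderiv t).deriv]
    have h := real_inner_le_norm (gradient f (p + t • v) + v) v
    rw [inner_add_left, real_inner_self_eq_norm_sq, hv] at h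
    nlinarith [hle (p + t • v), sq_nonneg (‖gradient f (p + t • v) + v‖ - 1)]
  have hC_nonneg : 0 ≤ C := (abs_nonneg _).trans (hC 0)
  have hε : 0 < 1/2 - (r : ℝ) := by linarith
  have hT : 0 ≤ (2 * C + 1) / (1/2 - r) := by positivity
  have hdrop := image_sub_le_mul_sub_of_deriv_le
    (fun t ↦ (hderiv t).differentiableAt) hslope hT
  have hmul : ((r : ℝ) - 1/2) * ((2 * C + 1) / (1/2 - r) - 0) = -(2 * C + 1) := by
    linear_combination -mul_div_cancel₀ (2 * C + 1) hε.ne'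
  rw [hmul] at hdrop
  linarith [(abs_le.mp (hC 0)).2, (abs_le.mp (hC ((2 * C + 1) / (1/2 - r)))).1]

/-- **Abbondandolo's example.**  For `n ≥ 2` and `e₁ = (1,0,…,0) ∈ ℝⁿ`:
(i) the infimum over all `C¹` functions `f : ℝⁿ → ℝ` of `sup_q ½‖∇f q + e₁‖²` is `0`;
(ii) the infimum of the same quantity over those `C¹` functions `f` that are bounded along
every horizontal line `t ↦ q + t • e₁` is `½`; in particular (iii) every such `f` satisfies
`sup_q ½‖∇f q + e₁‖² ≥ ½`. -/
theorem mane_critical_value_example (n : ℕ) (hn : 2 ≤ n) :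
    (⨅ f : {f : EuclideanSpace ℝ (Fin n) → ℝ // ContDiff ℝ 1 f},
        ⨆ q : EuclideanSpace ℝ (Fin n),
          ENNReal.ofReal
            ((1/2) * ‖gradient f.1 q + EuclideanSpace.single (⟨0, by omega⟩ : Fin n) (1:ℝ)‖^2))
      = 0 ∧
    (⨅ f : {f : EuclideanSpace ℝ (Fin n) → ℝ // ContDiff ℝ 1 f ∧
            ∀ q : EuclideanSpace ℝ (Fin n), ∃ C : ℝ, ∀ t : ℝ,
              |f (q + t • EuclideanSpace.single (⟨0, by omega⟩ : Fin n) (1:ℝ))| ≤ C},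
        ⨆ q : EuclideanSpace ℝ (Fin n),
          ENNReal.ofReal
            ((1/2) * ‖gradient f.1 q + EuclideanSpace.single (⟨0, by omega⟩ : Fin n) (1:ℝ)‖^2))
      = 1/2 ∧
    ∀ f : EuclideanSpace ℝ (Fin n) → ℝ, ContDiff ℝ 1 f →
      (∀ q : EuclideanSpace ℝ (Fin n), ∃ C : ℝ, ∀ t : ℝ,
          |f (q + t • EuclideanSpace.single (⟨0, by omega⟩ : Fin n) (1:ℝ))| ≤ C) →
      (1/2 : ℝ≥0∞) ≤
        ⨆ q : EuclideanSpace ℝ (Fin n),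
          ENNReal.ofReal
            ((1/2) * ‖gradient f q + EuclideanSpace.single (⟨0, by omega⟩ : Fin n) (1:ℝ)‖^2) := by
  have hv : ‖EuclideanSpace.single (⟨0, by omega⟩ : Fin n) (1:ℝ)‖ = 1 := by simp
  have hlower (f : EuclideanSpace ℝ (Fin n) → ℝ) (hf : ContDiff ℝ 1 f)
      (hb : ∀ q : EuclideanSpace ℝ (Fin n), ∃ C : ℝ, ∀ t : ℝ,
        |f (q + t • EuclideanSpace.single (⟨0, by omega⟩ : Fin n) (1:ℝ))| ≤ C) :=
    half_le_iSup_norm_gradient_add_sq (hf.differentiable one_ne_zero) hv (hb 0).choose_spec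
  refine ⟨?_, le_antisymm ?_ (le_iInf fun f ↦ hlower f.1 f.2.1 f.2.2), hlower⟩
  · generalize EuclideanSpace.single (⟨0, by omega⟩ : Fin n) (1:ℝ) = v
    refine le_antisymm (iInf_le_of_le ⟨fun q ↦ inner ℝ (-v) q, contDiff_const.inner ℝ contDiff_id⟩ ?_) zero_le
    have hgrad (q : EuclideanSpace ℝ (Fin n)) :
        gradient (fun q ↦ inner ℝ (-v) q) q = -v := by
      refine HasGradientAt.gradient ?_
      rw [hasGradientAt_iff_hasFDerivAt]
      exact (InnerProductSpace.toDual ℝ _ (-v)).hasFDerivAt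
    simp only [hgrad]
    simp
  · refine iInf_le_of_le ⟨fun _ ↦ 0, contDiff_const, fun _ ↦ ⟨0, by simp⟩⟩ (iSup_le fun q ↦ ?_)
    simp [gradient_fun_const, hv, ENNReal.ofReal_inv_of_pos]
end

section
/- Let E be a finite-dimensional real inner product space and let L : E → ℝ be a differentiable function that is strictly convex and superlinear, i.e. L(v)/‖v‖ → ∞ as ‖v‖ → ∞. Then the gradient map v ↦ ∇L(v) is a bijection from E onto E. -/
open Filter

theorem StrictConvexOn.add_fderiv_lt {E : Type*} [NormedAddCommGroup E] [NormedSpace ℝ E]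
    {L : E → ℝ} (hL : StrictConvexOn ℝ Set.univ L) {x y : E} (hx : DifferentiableAt ℝ L x)
    (hxy : x ≠ y) : L x + fderiv ℝ L x (y - x) < L y := by
  have hline : StrictConvexOn ℝ Set.univ (fun t : ℝ => L (AffineMap.lineMap x y t)) := by
    refine ⟨convex_univ, fun s _ t _ hst a b ha hb hab => ?_⟩
    simp only [Convex.combo_affine_apply hab]
    exact hL.2 trivial trivial ((AffineMap.lineMap_injective ℝ hxy).ne hst) ha hb hab
  have hderiv : HasDerivAt (fun t : ℝ => L (AffineMap.lineMap x y t))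
      (fderiv ℝ L x (y - x)) 0 := by
    have hx' : HasFDerivAt L (fderiv ℝ L x) (AffineMap.lineMap x y (0 : ℝ)) := by
      simpa using hx.hasFDerivAt
    exact hx'.comp_hasDerivAt 0 AffineMap.hasDerivAt_lineMap
  have hslope := hline.lt_slope_of_hasDerivAt trivial trivial zero_lt_one hderiv
  simp only [slope_def_field, AffineMap.lineMap_apply_one, AffineMap.lineMap_apply_zero, sub_zero,
    div_one] at hslope
  linarith

theorem StrictConvexOn.gradient_injective {E : Type*} [NormedAddCommGroup E]
    [InnerProductSpace ℝ E] [CompleteSpace E] {L : E → ℝ} (hL : StrictConvexOn ℝ Set.univ L)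
    (hdiff : Differentiable ℝ L) : Function.Injective (gradient L) := by
  intro x y hxy
  by_contra hne
  have h₁ := hL.add_fderiv_lt (hdiff x) hne
  have h₂ := hL.add_fderiv_lt (hdiff y) (Ne.symm hne)
  rw [← inner_gradient_left, inner_sub_right] at h₁ h₂
  rw [hxy] at h₁
  linarith

theorem gradient_surjective_of_superlinear {E : Type*} [NormedAddCommGroup E]
    [InnerProductSpace ℝ E] [FiniteDimensional ℝ E] {L : E → ℝ} (hdiff : Differentiable ℝ L)
    (hsuper : Tendsto (fun v => L v / ‖v‖) (cocompact E) atTop) :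
    Function.Surjective (gradient L) := by
  have := FiniteDimensional.proper_real E
  intro p
  have hfar : ∀ᶠ v in cocompact E, L 0 - inner ℝ p 0 ≤ L v - inner ℝ p v := by
    filter_upwards [hsuper.eventually_ge_atTop (‖p‖ + |L 0|),
      (tendsto_norm_cocompact_atTop (E := E)).eventually_ge_atTop 1] with v hv hv1
    rw [le_div_iff₀ (by linarith)] at hv
    have hp := real_inner_le_norm p v
    have h0 : L 0 ≤ |L 0| * ‖v‖ :=
      (le_abs_self _).trans (le_mul_of_one_le_right (abs_nonneg _) hv1)
    rw [inner_zero_right]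
    linarith
  have hcont : Continuous (fun v => L v - inner ℝ p v) :=
    hdiff.continuous.sub (continuous_const.inner continuous_id)
  obtain ⟨v, hv⟩ := hcont.exists_forall_le' 0 hfar
  refine ⟨v, (hasGradientAt_iff_hasFDerivAt.2 ?_).gradient⟩
  have hmin : IsLocalMin (fun v => L v - inner ℝ p v) v := Eventually.of_forall hv
  have hzero := hmin.hasFDerivAt_eq_zero
    ((hdiff v).hasFDerivAt.sub (InnerProductSpace.toDual ℝ E p).hasFDerivAt)
  rw [← sub_eq_zero.1 hzero]
  exact (hdiff v).hasFDerivAt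

/-- Let `E` be a finite-dimensional real inner product space and
`L : E → ℝ` a differentiable, strictly convex, superlinear function
(`L v / ‖v‖ → ∞` as `‖v‖ → ∞`). Then the gradient map `v ↦ ∇L v` is a bijection of `E`. -/
theorem gradient_bijective_of_strictConvex_superlinear
    (E : Type*) [NormedAddCommGroup E] [InnerProductSpace ℝ E] [FiniteDimensional ℝ E]
    (L : E → ℝ) (hdiff : Differentiable ℝ L)
    (hconv : StrictConvexOn ℝ Set.univ L)
    (hsuper : Tendsto (fun v => L v / ‖v‖) (cocompact E) atTop) :
    Function.Bijective (fun v => gradient L v) :=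
  ⟨hconv.gradient_injective hdiff, gradient_surjective_of_superlinear hdiff hsuper⟩
end
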